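/- Let Φ_S : Set ℝ → Set ℝ be the monotone operator Φ_S(X) = {x : ℝ | |x| ≤ 1 ∧ ∃ d ∈ ({-1, 0, 1} : Set ℝ), 2*x - d ∈ X}. Then the greatest fixed point of Φ_S (in the complete lattice Set ℝ) equals the closed interval Set.Icc (-1 : ℝ) 1. (Classical content of the coinductive predicate S: a real number satisfies S iff it lies in [-1,1].) -/

import Mathlib

def PhiS : Set ℝ →o Set ℝ :=
  ⟨fun X => {x : ℝ | |x| ≤ 1 ∧ ∃ d ∈ ({-1, 0, 1} : Set ℝ), 2 * x - d ∈ X},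
   fun X Y h x hx => ⟨hx.1, by obtain ⟨d, hd, hm⟩ := hx.2; exact ⟨d, hd, h hm⟩⟩⟩

theorem gfp_PhiS_eq_Icc : OrderHom.gfp PhiS = Set.Icc (-1 : ℝ) 1 := by
  apply le_antisymm
  · refine OrderHom.gfp_le _ fun X hX x hx => ?_
    exact abs_le.mp (hX hx).1
  · refine OrderHom.le_gfp _ fun x hx => ⟨abs_le.mpr hx, ?_⟩
    obtain ⟨hl, hu⟩ := hx
    rcases le_total x 0 with h | h
    · exact ⟨-1, by simp, by constructor <;> linarith⟩
    · exact ⟨1, by simp, by constructor <;> linarith⟩
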